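/- Let a<b be real numbers and let ψ : ℝ → ]0,+∞[ be a bounded Borel function such that M := ∫_{−∞}^{+∞} ψ(t) dt < +∞, inf_K ψ > 0 for every compact K ⊂ ℝ, and additionally ψ(t) ≤ c/t^α for all t ≥ 1, for some constants c > 0 and α > 1. Then there exists a function u ∈ X¹_ψ(]a,b[) whose derivative has nontrivial Cantor part, i.e. (u')^c ≠ 0. -/

import Mathlib

open MeasureTheory Filter Set Topology
open scoped ENNReal NNReal

noncomputable section

/-- `Ψ₁(t) = ∫_{-∞}^t ψ(s) ds`. -/
def Psi1 (ψ : ℝ → ℝ) (t : ℝ) : ℝ := ∫ s in Set.Iic t, ψ s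

/-- `Ψ_p(t) = ∫_{-∞}^t ψ(s)^{1/p} ds`. -/
def Psip (ψ : ℝ → ℝ) (p t : ℝ) : ℝ := ∫ s in Set.Iic t, ψ s ^ (1 / p)

/-- The natural extension of `Ψ₁` to the extended reals:
`Ψ₁(-∞) = 0`, `Ψ₁(+∞) = ∫_ℝ ψ`. -/
def Psi1E (ψ : ℝ → ℝ) (t : EReal) : ℝ :=
  if t = ⊤ then ∫ s, ψ s else if t = ⊥ then 0 else Psi1 ψ t.toReal

/-- Standing assumptions on `ψ` in the case `p = 1`: a bounded, everywhere positive
Borel function, integrable on `ℝ`, whose infimum on every compact set is positive. -/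
structure PsiHyp (ψ : ℝ → ℝ) : Prop where
  measurable : Measurable ψ
  pos : ∀ t, 0 < ψ t
  bounded : ∃ C, ∀ t, ψ t ≤ C
  integrable : MeasureTheory.Integrable ψ
  inf_pos : ∀ K : Set ℝ, IsCompact K → ∃ δ > 0, ∀ t ∈ K, δ ≤ ψ t

/-- Standing assumptions on `ψ` in the case `p > 1`: as in `PsiHyp` but with
`ψ^{1/p}` integrable on `ℝ`. -/
structure PsiHypP (ψ : ℝ → ℝ) (p : ℝ) : Prop where
  measurable : Measurable ψ
  pos : ∀ t, 0 < ψ t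
  bounded : ∃ C, ∀ t, ψ t ≤ C
  integrable : MeasureTheory.Integrable fun t => ψ t ^ (1 / p)
  inf_pos : ∀ K : Set ℝ, IsCompact K → ∃ δ > 0, ∀ t ∈ K, δ ≤ ψ t

/-- `(μp, μn)` is the Jordan decomposition of the distributional derivative of
`u ∈ L¹(]a,b[)`; the existence of such a pair encodes `u ∈ BV(]a,b[)`,
and `μp + μn` is the total variation measure `|u'|`. -/
def IsDerivMeasures (a b : ℝ) (u : ℝ → ℝ) (μp μn : Measure ℝ) : Prop :=
  MeasureTheory.IntegrableOn u (Set.Ioo a b) ∧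
  IsFiniteMeasure μp ∧ IsFiniteMeasure μn ∧ μp ⟂ₘ μn ∧
  μp (Set.Ioo a b)ᶜ = 0 ∧ μn (Set.Ioo a b)ᶜ = 0 ∧
  ∀ φ : ℝ → ℝ, ContDiff ℝ 1 φ → tsupport φ ⊆ Set.Ioo a b →
    ∫ x in Set.Ioo a b, u x * deriv φ x = (∫ x, φ x ∂μn) - ∫ x, φ x ∂μp

/-- The density `(u')^a` of the absolutely continuous part of the derivative whose
Jordan decomposition is `(μp, μn)`. -/
def uaD (μp μn : Measure ℝ) (x : ℝ) : ℝ :=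
  (μp.rnDeriv MeasureTheory.volume x).toReal - (μn.rnDeriv MeasureTheory.volume x).toReal

/-- Left approximate limit `u₋(y) = lim_{ε→0⁺} ε⁻¹ ∫_{y-ε}^y u`. -/
def leftApproxLim (u : ℝ → ℝ) (y : ℝ) : ℝ :=
  limUnder (𝓝[>] (0 : ℝ)) fun ε => (∫ x in Set.Ioo (y - ε) y, u x) / ε

/-- Right approximate limit `u₊(y) = lim_{ε→0⁺} ε⁻¹ ∫_y^{y+ε} u`. -/
def rightApproxLim (u : ℝ → ℝ) (y : ℝ) : ℝ :=
  limUnder (𝓝[>] (0 : ℝ)) fun ε => (∫ x in Set.Ioo y (y + ε), u x) / ε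

/-- Left approximate limit computed in the extended reals (may be `±∞`). -/
def leftApproxLimE (u : ℝ → ℝ) (y : ℝ) : EReal :=
  limUnder (𝓝[>] (0 : ℝ)) fun ε => (((∫ x in Set.Ioo (y - ε) y, u x) / ε : ℝ) : EReal)

/-- Right approximate limit computed in the extended reals (may be `±∞`). -/
def rightApproxLimE (u : ℝ → ℝ) (y : ℝ) : EReal :=
  limUnder (𝓝[>] (0 : ℝ)) fun ε => (((∫ x in Set.Ioo y (y + ε), u x) / ε : ℝ) : EReal)

/-- The jump set `S_u` of `u` in `]a,b[`. -/
def jumpSet (a b : ℝ) (u : ℝ → ℝ) : Set ℝ :=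
  {y | y ∈ Set.Ioo a b ∧ leftApproxLim u y ≠ rightApproxLim u y}

/-- `ν_u = sign(u₊ - u₋)`. -/
def jumpSign (u : ℝ → ℝ) (y : ℝ) : ℝ :=
  Real.sign (rightApproxLim u y - leftApproxLim u y)

/-- `Z⁺[w] = {x ∈ ]a,b[ : lim_{ε→0⁺} (2ε)⁻¹∫_{x-ε}^{x+ε} w = +∞}`. -/
def ZPlus (a b : ℝ) (w : ℝ → ℝ) : Set ℝ :=
  {x | x ∈ Set.Ioo a b ∧
    Tendsto (fun ε => (∫ t in Set.Ioo (x - ε) (x + ε), w t) / (2 * ε)) (𝓝[>] (0 : ℝ)) atTop}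

/-- `Z⁻[w] = {x ∈ ]a,b[ : lim_{ε→0⁺} (2ε)⁻¹∫_{x-ε}^{x+ε} w = -∞}`. -/
def ZMinus (a b : ℝ) (w : ℝ → ℝ) : Set ℝ :=
  {x | x ∈ Set.Ioo a b ∧
    Tendsto (fun ε => (∫ t in Set.Ioo (x - ε) (x + ε), w t) / (2 * ε)) (𝓝[>] (0 : ℝ)) atBot}

/-- The positive part `((u')^c)⁺` of the Cantor part of the derivative of `u`:
the singular part of `μp` with the atoms on the jump set removed. -/
def cantorPos (a b : ℝ) (u : ℝ → ℝ) (μp : Measure ℝ) : Measure ℝ :=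
  (μp.singularPart MeasureTheory.volume).restrict (jumpSet a b u)ᶜ

/-- The negative part `((u')^c)⁻` of the Cantor part of the derivative of `u`. -/
def cantorNeg (a b : ℝ) (u : ℝ → ℝ) (μn : Measure ℝ) : Measure ℝ :=
  (μn.singularPart MeasureTheory.volume).restrict (jumpSet a b u)ᶜ

/-- `u ∈ X¹_ψ(]a,b[)`, with derivative data `(μp, μn)`:  `u ∈ BV(]a,b[)`,
`Ψ₁∘(u')^a ∈ BV(]a,b[)`, and `((u')^c)^±` is concentrated on `Z^±[(u')^a]`. -/
def MemX1 (ψ : ℝ → ℝ) (a b : ℝ) (u : ℝ → ℝ) (μp μn : Measure ℝ) : Prop :=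
  IsDerivMeasures a b u μp μn ∧
  (∃ νp νn : Measure ℝ, IsDerivMeasures a b (fun x => Psi1 ψ (uaD μp μn x)) νp νn) ∧
  cantorPos a b u μp (ZPlus a b (uaD μp μn))ᶜ = 0 ∧
  cantorNeg a b u μn (ZMinus a b (uaD μp μn))ᶜ = 0

/-- `f ∈ W^{1,p}(]a,b[)`: `f` has an absolutely continuous representative whose
pointwise a.e. derivative lies in `L^p(]a,b[)`. -/
def MemW1pOn (p a b : ℝ) (f : ℝ → ℝ) : Prop :=
  ∃ g w : ℝ → ℝ,
    (∀ᵐ x ∂(MeasureTheory.volume.restrict (Set.Ioo a b)), g x = f x) ∧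
    MeasureTheory.IntegrableOn w (Set.Ioo a b) ∧
    MeasureTheory.IntegrableOn (fun x => |w x| ^ p) (Set.Ioo a b) ∧
    ∀ x ∈ Set.Ioo a b, ∀ y ∈ Set.Ioo a b, g y - g x = ∫ t in x..y, w t

/-- `u ∈ X^p_ψ(]a,b[)`, with derivative data `(μp, μn)`:  `u ∈ BV(]a,b[)`,
`Ψ_p∘(u')^a ∈ W^{1,p}(]a,b[)`, and `((u')^s)^±` is concentrated on `Z^±[(u')^a]`. -/
def MemXp (ψ : ℝ → ℝ) (p a b : ℝ) (u : ℝ → ℝ) (μp μn : Measure ℝ) : Prop :=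
  IsDerivMeasures a b u μp μn ∧
  MemW1pOn p a b (fun x => Psip ψ p (uaD μp μn x)) ∧
  (μp.singularPart MeasureTheory.volume) (ZPlus a b (uaD μp μn))ᶜ = 0 ∧
  (μn.singularPart MeasureTheory.volume) (ZMinus a b (uaD μp μn))ᶜ = 0

/-- `u ∈ W^{2,p}(]a,b[)` with first derivative `v` and second derivative `w`. -/
def W2pRep (p a b : ℝ) (u v w : ℝ → ℝ) : Prop :=
  (∀ x ∈ Set.Ioo a b, HasDerivAt u (v x) x) ∧
  (∀ x ∈ Set.Ioo a b, ∀ y ∈ Set.Ioo a b, v y - v x = ∫ t in x..y, w t) ∧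
  MeasureTheory.IntegrableOn u (Set.Ioo a b) ∧
  MeasureTheory.IntegrableOn v (Set.Ioo a b) ∧
  MeasureTheory.IntegrableOn w (Set.Ioo a b) ∧
  MeasureTheory.IntegrableOn (fun x => |w x| ^ p) (Set.Ioo a b)

/-- The functional `F_p(u) = ∫_a^b |u'| + ∫_a^b ψ(u')|u''|^p` if `u ∈ W^{2,p}(]a,b[)`,
`+∞` otherwise (as an infimum over Sobolev representations). -/
def Fp (ψ : ℝ → ℝ) (p a b : ℝ) (u : ℝ → ℝ) : ℝ≥0∞ :=
  ⨅ (v : ℝ → ℝ) (w : ℝ → ℝ) (_ : W2pRep p a b u v w),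
    ENNReal.ofReal ((∫ x in Set.Ioo a b, |v x|) + ∫ x in Set.Ioo a b, ψ (v x) * |w x| ^ p)

/-- Strong `L¹(]a,b[)` convergence of a sequence. -/
def TendstoL1 (a b : ℝ) (U : ℕ → ℝ → ℝ) (u : ℝ → ℝ) : Prop :=
  (∀ k, MeasureTheory.IntegrableOn (U k) (Set.Ioo a b)) ∧
  MeasureTheory.IntegrableOn u (Set.Ioo a b) ∧
  Tendsto (fun k => ∫ x in Set.Ioo a b, |U k x - u x|) atTop (𝓝 0)

/-- The relaxed functional
`F̄_p(u) = inf { liminf_k F_p(u_k) : u_k → u in L¹(]a,b[) }`. -/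
def FpRel (ψ : ℝ → ℝ) (p a b : ℝ) (u : ℝ → ℝ) : ℝ≥0∞ :=
  ⨅ (U : ℕ → ℝ → ℝ) (_ : TendstoL1 a b U u),
    liminf (fun k => Fp ψ p a b (U k)) atTop

/-- `Φ(s, t₁, t₂)` of the relaxation formula (`s` being the sign of the jump). -/
def Phi (ψ : ℝ → ℝ) (s : ℝ) (t₁ t₂ : EReal) : ℝ :=
  if 0 < s then ((∫ t, ψ t) - Psi1E ψ t₁) + ((∫ t, ψ t) - Psi1E ψ t₂)
  else Psi1E ψ t₁ + Psi1E ψ t₂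

/-- `Φ̂(s, t₁, t₂)` of Remark 2.5. -/
def PhiHat (ψ : ℝ → ℝ) (s : ℝ) (t₁ t₂ : EReal) : ℝ :=
  if 0 < s then (∫ t, ψ t) - Psi1E ψ (max t₁ t₂)
  else Psi1E ψ (min t₁ t₂)

/-- `ubar` is a `C¹([a,b])` representative of `u`. -/
def C1Rep (a b : ℝ) (u ubar : ℝ → ℝ) : Prop :=
  (∀ᵐ x ∂(MeasureTheory.volume.restrict (Set.Ioo a b)), ubar x = u x) ∧
  ContDiffOn ℝ 1 ubar (Set.Icc a b)

/-- `u` solves `min { F̄₁(w) + λ ∫_a^b (w - G)² : w ∈ X¹_ψ(]a,b[) }`. -/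
def IsSolution1 (ψ : ℝ → ℝ) (a b lam : ℝ) (G u : ℝ → ℝ) : Prop :=
  (∃ μp μn : Measure ℝ, MemX1 ψ a b u μp μn) ∧
  ∀ w : ℝ → ℝ, (∃ ηp ηn : Measure ℝ, MemX1 ψ a b w ηp ηn) →
    FpRel ψ 1 a b u + ENNReal.ofReal (lam * ∫ x in Set.Ioo a b, (u x - G x) ^ 2) ≤
    FpRel ψ 1 a b w + ENNReal.ofReal (lam * ∫ x in Set.Ioo a b, (w x - G x) ^ 2)

/-- `u` solves `min { F̄_p(w) + λ ∫_a^b |w - G|² : w ∈ X^p_ψ(]a,b[) }`. -/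
def IsSolutionP (ψ : ℝ → ℝ) (p a b lam : ℝ) (G u : ℝ → ℝ) : Prop :=
  (∃ μp μn : Measure ℝ, MemXp ψ p a b u μp μn) ∧
  ∀ w : ℝ → ℝ, (∃ ηp ηn : Measure ℝ, MemXp ψ p a b w ηp ηn) →
    FpRel ψ p a b u + ENNReal.ofReal (lam * ∫ x in Set.Ioo a b, (u x - G x) ^ 2) ≤
    FpRel ψ p a b w + ENNReal.ofReal (lam * ∫ x in Set.Ioo a b, (w x - G x) ^ 2)

/-- The Rudin–Osher–Fatemi energy `|w'|(]a,b[) + λ∫_a^b (w-g)²`, where `(ηp, ηn)`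
is the Jordan decomposition of the derivative of `w`. -/
def ROFenergy (a b lam : ℝ) (g w : ℝ → ℝ) (ηp ηn : Measure ℝ) : ℝ≥0∞ :=
  (ηp + ηn) (Set.Ioo a b) + ENNReal.ofReal (lam * ∫ x in Set.Ioo a b, (w x - g x) ^ 2)

/-- The left-continuous generalized inverse `g^{-1}(c) = inf {x ∈ [a,b] : g(x) ≥ c}`. -/
def gInv (a b : ℝ) (g : ℝ → ℝ) (c : ℝ) : ℝ :=
  sInf {x | x ∈ Set.Icc a b ∧ c ≤ g x}

end

noncomputable section
open MeasureTheory Filter Set Topology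
open scoped ENNReal NNReal

/-- Integration by parts for the distribution function of a finite measure. -/
lemma integral_measureReal_Iic_mul_deriv (μ : Measure ℝ) [IsFiniteMeasure μ] {a b : ℝ}
    {φ : ℝ → ℝ} (hφ : ContDiff ℝ 1 φ) (hs : tsupport φ ⊆ Ioo a b) :
    ∫ x in Ioo a b, μ.real (Iic x) * deriv φ x = -∫ x, φ x ∂μ := by
  have hc : HasCompactSupport φ :=
    isCompact_Icc.of_isClosed_subset (isClosed_tsupport φ) (hs.trans Ioo_subset_Icc_self)
  have hint : Integrable (deriv φ) :=
    (hφ.continuous_deriv le_rfl).integrable_of_hasCompactSupport hc.deriv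
  rw [setIntegral_eq_integral_of_forall_compl_eq_zero]
  swap
  · intro x hx
    have : deriv φ x = 0 := by
      by_contra h
      exact hx (hs (support_deriv_subset h))
    simp [this]
  have hmeas : MeasurableSet {p : ℝ × ℝ | p.2 ≤ p.1} := measurableSet_le measurable_snd measurable_fst
  have hG : Integrable (Function.uncurry fun x y : ℝ =>
      {p : ℝ × ℝ | p.2 ≤ p.1}.indicator (fun p => deriv φ p.1) (x, y)) (volume.prod μ) :=
    (hint.comp_fst μ).indicator hmeas
  have h1 : ∀ x, μ.real (Iic x) * deriv φ x =
      ∫ y, {p : ℝ × ℝ | p.2 ≤ p.1}.indicator (fun p => deriv φ p.1) (x, y) ∂μ := by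
    intro x
    have : (fun y => {p : ℝ × ℝ | p.2 ≤ p.1}.indicator (fun p => deriv φ p.1) (x, y)) =
        (Iic x).indicator (fun _ => deriv φ x) := by
      ext y; simp [indicator]
    rw [this, integral_indicator measurableSet_Iic]
    simp
  have h2 : ∀ y, ∫ x, {p : ℝ × ℝ | p.2 ≤ p.1}.indicator (fun p => deriv φ p.1) (x, y) = - φ y := by
    intro y
    have : (fun x => {p : ℝ × ℝ | p.2 ≤ p.1}.indicator (fun p => deriv φ p.1) (x, y)) =
        (Ici y).indicator (deriv φ) := by
      ext x; simp [indicator]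
    rw [this, integral_indicator measurableSet_Ici, integral_Ici_eq_integral_Ioi,
      hc.integral_Ioi_deriv_eq hφ]
  simp_rw [h1]
  rw [integral_integral_swap hG]
  simp_rw [h2]
  exact integral_neg _

lemma ae_measureReal_Iio_eq_Iic (μ : Measure ℝ) [IsFiniteMeasure μ] :
    ∀ᵐ x : ℝ, μ.real (Iio x) = μ.real (Iic x) := by
  have hcount : {x : ℝ | 0 < μ {x}}.Countable :=
    Measure.countable_meas_pos_of_disjoint_iUnion (fun x => measurableSet_singleton x)
      (fun x y h => by simpa using h)
  filter_upwards [hcount.ae_notMem volume] with x hx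
  have h0 : μ {x} = 0 := by simpa using hx
  rw [measureReal_def, measureReal_def, ← Iio_union_right]
  congr 1
  refine le_antisymm (measure_mono subset_union_left) ((measure_union_le _ _).trans ?_)
  simp [h0]

lemma monotone_measureReal_Iic (μ : Measure ℝ) [IsFiniteMeasure μ] :
    Monotone fun x => μ.real (Iic x) :=
  fun _ _ h => measureReal_mono (Iic_subset_Iic.2 h)

lemma integrableOn_measureReal_Iic (μ : Measure ℝ) [IsFiniteMeasure μ] (a b : ℝ) :
    IntegrableOn (fun x => μ.real (Iic x)) (Ioo a b) :=
  ((monotone_measureReal_Iic μ).locallyIntegrable.integrableOn_isCompact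
    (isCompact_Icc (a := a) (b := b))).mono_set Ioo_subset_Icc_self

lemma continuous_measureReal_Iic (μ : Measure ℝ) [IsFiniteMeasure μ] [NullSingletonClass μ] :
    Continuous fun x => μ.real (Iic x) := by
  have h : (fun x => μ.real (Iic x)) = fun x => ∫ y, (Iic x).indicator (fun _ => (1 : ℝ)) y ∂μ := by
    ext x; rw [integral_indicator measurableSet_Iic]; simp
  rw [h, continuous_iff_continuousAt]
  intro x₀
  refine continuousAt_of_dominated (bound := fun _ => 1)
    (.of_forall fun x => (measurable_const.indicator measurableSet_Iic).aestronglyMeasurable)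
    (.of_forall fun x => .of_forall fun y => ?_) (integrable_const _) ?_
  · by_cases hy : y ∈ Iic x <;> simp [hy]
  · have : ∀ᵐ y ∂μ, y ≠ x₀ := by simp [ae_iff]
    filter_upwards [this] with y hy
    rcases lt_or_gt_of_ne hy with h | h
    · refine (continuousAt_const (y := (1 : ℝ))).congr ?_
      filter_upwards [Ioi_mem_nhds h] with x hx
      simp [indicator, (mem_Ioi.1 hx).le]
    · refine (continuousAt_const (y := (0 : ℝ))).congr ?_
      filter_upwards [Iio_mem_nhds h] with x hx
      simp [indicator, mem_Iio.1 hx]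

lemma tsupport_zero_of_notMem {φ : ℝ → ℝ} {s : Set ℝ} (hs : tsupport φ ⊆ s) {x : ℝ} (hx : x ∉ s) :
    φ x = 0 := image_eq_zero_of_notMem_tsupport fun h => hx (hs h)

lemma measure_sub_add_comm {α : Type*} [MeasurableSpace α] (σ τ : Measure α) [IsFiniteMeasure σ]
    [IsFiniteMeasure τ] : (σ - τ) + τ = (τ - σ) + σ := by
  have h := Measure.sub_toSignedMeasure_eq_toSignedMeasure_sub (μ := σ) (ν := τ)
  rw [eq_comm, sub_eq_sub_iff_add_eq_add, add_comm σ.toSignedMeasure,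
    ← Measure.toSignedMeasure_add, ← Measure.toSignedMeasure_add] at h
  exact Measure.toSignedMeasure_eq_toSignedMeasure_iff.1 h

lemma integral_add_sub_mul_deriv (σ τ : Measure ℝ) [IsFiniteMeasure σ] [IsFiniteMeasure τ]
    {a b K : ℝ} {v φ : ℝ → ℝ}
    (hv : ∀ᵐ x ∂volume.restrict (Ioo a b), v x = K + σ.real (Iic x) - τ.real (Iic x))
    (hφ : ContDiff ℝ 1 φ) (hs : tsupport φ ⊆ Ioo a b) :
    ∫ x in Ioo a b, v x * deriv φ x = (∫ x, φ x ∂τ) - ∫ x, φ x ∂σ := by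
  have hc : HasCompactSupport φ :=
    isCompact_Icc.of_isClosed_subset (isClosed_tsupport φ) (hs.trans Ioo_subset_Icc_self)
  have hcont := hφ.continuous_deriv le_rfl
  have hint : Integrable (deriv φ) := hcont.integrable_of_hasCompactSupport hc.deriv
  obtain ⟨A, hA⟩ := hc.deriv.exists_bound_of_continuous hcont
  have hprod (μ : Measure ℝ) [IsFiniteMeasure μ] :
      IntegrableOn (fun x => μ.real (Iic x) * deriv φ x) (Ioo a b) :=
    (integrableOn_measureReal_Iic μ a b).mul_bdd hcont.aestronglyMeasurable (.of_forall hA)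
  have hK : ∫ x in Ioo a b, deriv φ x = 0 := by
    rw [setIntegral_eq_integral_of_forall_compl_eq_zero
      fun x hx => tsupport_zero_of_notMem ((tsupport_deriv_subset (𝕜 := ℝ)).trans hs) hx]
    exact integral_eq_zero_of_hasDerivAt_of_integrable
      (fun x => (hφ.differentiable one_ne_zero x).hasDerivAt) hint
      (hφ.continuous.integrable_of_hasCompactSupport hc)
  calc ∫ x in Ioo a b, v x * deriv φ x
      = ∫ x in Ioo a b, (K * deriv φ x + σ.real (Iic x) * deriv φ x
          - τ.real (Iic x) * deriv φ x) := by
        refine integral_congr_ae ?_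
        filter_upwards [hv] with x hx
        rw [hx]; ring
    _ = _ := by
        have hsum : IntegrableOn (fun x => K * deriv φ x + σ.real (Iic x) * deriv φ x) (Ioo a b) :=
          (hint.integrableOn.const_mul K).add (hprod σ)
        rw [integral_sub hsum (hprod τ), integral_add (hint.integrableOn.const_mul K) (hprod σ), integral_const_mul, hK,
          integral_measureReal_Iic_mul_deriv σ hφ hs, integral_measureReal_Iic_mul_deriv τ hφ hs]
        ring

lemma integrable_of_tsupport_subset_Ioo (μ : Measure ℝ) [IsFiniteMeasure μ] {a b : ℝ} {φ : ℝ → ℝ}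
    (hφ : ContDiff ℝ 1 φ) (hs : tsupport φ ⊆ Ioo a b) : Integrable φ μ :=
  hφ.continuous.integrable_of_hasCompactSupport
    (isCompact_Icc.of_isClosed_subset (isClosed_tsupport φ) (hs.trans Ioo_subset_Icc_self))

/-- A function which is a.e. the difference of two distribution functions is of bounded
variation. -/
lemma exists_isDerivMeasures (σ τ : Measure ℝ) [IsFiniteMeasure σ] [IsFiniteMeasure τ]
    {a b K : ℝ} {v : ℝ → ℝ}
    (hv : ∀ᵐ x ∂volume.restrict (Ioo a b), v x = K + σ.real (Iic x) - τ.real (Iio x)) :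
    ∃ νp νn : Measure ℝ, IsDerivMeasures a b v νp νn := by
  have hv' : ∀ᵐ x ∂volume.restrict (Ioo a b), v x = K + σ.real (Iic x) - τ.real (Iic x) := by
    filter_upwards [hv, ae_restrict_of_ae (ae_measureReal_Iio_eq_Iic τ)] with x h1 h2
    rw [h1, h2]
  refine ⟨(σ - τ).restrict (Ioo a b), (τ - σ).restrict (Ioo a b), ?_, inferInstance,
    inferInstance, ?_, ?_, ?_, ?_⟩
  · have h : IntegrableOn (fun x => K + σ.real (Iic x) - τ.real (Iic x)) (Ioo a b) :=
      ((integrableOn_const (by simp)).add (integrableOn_measureReal_Iic σ a b)).sub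
        (integrableOn_measureReal_Iic τ a b)
    exact h.congr (hv'.mono fun x hx => hx.symm)
  · exact Measure.mutually_singular_measure_sub.mono_ac Measure.absolutelyContinuous_restrict
      Measure.absolutelyContinuous_restrict
  · simp [Measure.restrict_apply measurableSet_Ioo.compl]
  · simp [Measure.restrict_apply measurableSet_Ioo.compl]
  · intro φ hφ hs
    have hz : ∀ x ∉ Ioo a b, φ x = 0 := fun x hx => tsupport_zero_of_notMem hs hx
    rw [setIntegral_eq_integral_of_forall_compl_eq_zero hz,
      setIntegral_eq_integral_of_forall_compl_eq_zero hz, integral_add_sub_mul_deriv σ τ hv' hφ hs]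
    have hi (μ : Measure ℝ) [IsFiniteMeasure μ] := integrable_of_tsupport_subset_Ioo μ hφ hs
    have h := congrArg (fun μ => ∫ x, φ x ∂μ) (measure_sub_add_comm σ τ)
    simp only [integral_add_measure (hi _) (hi _)] at h
    linarith

lemma isDerivMeasures_measureReal_Iic (μ : Measure ℝ) [IsFiniteMeasure μ] {a b : ℝ}
    (hμ : μ (Ioo a b)ᶜ = 0) : IsDerivMeasures a b (fun x => μ.real (Iic x)) μ 0 := by
  refine ⟨integrableOn_measureReal_Iic μ a b, inferInstance, inferInstance,
    Measure.MutuallySingular.zero_right, hμ, by simp, fun φ hφ hs => ?_⟩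
  rw [integral_measureReal_Iic_mul_deriv μ hφ hs]
  simp

lemma leftApproxLim_eq_of_continuous {u : ℝ → ℝ} (hm : Monotone u) (hu : Continuous u) (y : ℝ) :
    leftApproxLim u y = u y := by
  have hint (s t : ℝ) : IntegrableOn u (Ioo s t) :=
    (hu.integrableOn_Icc (a := s) (b := t)).mono_set Ioo_subset_Icc_self
  have hlim : Tendsto (fun ε => u (y - ε)) (𝓝[>] (0 : ℝ)) (𝓝 (u y)) := by
    have : Continuous fun ε => u (y - ε) := by fun_prop
    simpa using (this.tendsto 0).mono_left nhdsWithin_le_nhds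
  refine Tendsto.limUnder_eq (tendsto_of_tendsto_of_tendsto_of_le_of_le' hlim tendsto_const_nhds
    ?_ ?_) <;> filter_upwards [self_mem_nhdsWithin] with ε hε
  · have hε' : (0 : ℝ) < ε := hε
    rw [le_div_iff₀ hε']
    have := setIntegral_mono_on (integrableOn_const (by simp)) (hint (y - ε) y) measurableSet_Ioo
      (fun x hx => hm hx.1.le)
    simpa [hε'.le, mul_comm] using this
  · have hε' : (0 : ℝ) < ε := hε
    rw [div_le_iff₀ hε']
    have := setIntegral_mono_on (hint (y - ε) y) (integrableOn_const (by simp)) measurableSet_Ioo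
      (fun x hx => hm hx.2.le)
    simpa [hε'.le, mul_comm] using this

lemma rightApproxLim_eq_of_continuous {u : ℝ → ℝ} (hm : Monotone u) (hu : Continuous u) (y : ℝ) :
    rightApproxLim u y = u y := by
  have hint (s t : ℝ) : IntegrableOn u (Ioo s t) :=
    (hu.integrableOn_Icc (a := s) (b := t)).mono_set Ioo_subset_Icc_self
  have hlim : Tendsto (fun ε => u (y + ε)) (𝓝[>] (0 : ℝ)) (𝓝 (u y)) := by
    have : Continuous fun ε => u (y + ε) := by fun_prop
    simpa using (this.tendsto 0).mono_left nhdsWithin_le_nhds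
  refine Tendsto.limUnder_eq (tendsto_of_tendsto_of_tendsto_of_le_of_le' tendsto_const_nhds hlim
    ?_ ?_) <;> filter_upwards [self_mem_nhdsWithin] with ε hε
  · have hε' : (0 : ℝ) < ε := hε
    rw [le_div_iff₀ hε']
    have := setIntegral_mono_on (integrableOn_const (by simp)) (hint y (y + ε)) measurableSet_Ioo
      (fun x hx => hm hx.1.le)
    simpa [hε'.le, mul_comm] using this
  · have hε' : (0 : ℝ) < ε := hε
    rw [div_le_iff₀ hε']
    have := setIntegral_mono_on (hint y (y + ε)) (integrableOn_const (by simp)) measurableSet_Ioo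
      (fun x hx => hm hx.2.le)
    simpa [hε'.le, mul_comm] using this

lemma jumpSet_eq_empty_of_continuous {u : ℝ → ℝ} (hm : Monotone u) (hu : Continuous u)
    (a b : ℝ) : jumpSet a b u = ∅ := by
  ext y
  simp [jumpSet, leftApproxLim_eq_of_continuous hm hu, rightApproxLim_eq_of_continuous hm hu]

/-- The `n`-th stage of the Cantor set in `[p, q]` with contraction ratio `δ`. -/
def cantorStage (p q δ : ℝ) : ℕ → Set ℝ
  | 0 => Icc p q
  | n + 1 => (fun x => p + (x - p) / δ) ⁻¹' cantorStage p q δ n ∪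
      (fun x => q + (x - q) / δ) ⁻¹' cantorStage p q δ n

section cantorStage

variable {p q δ : ℝ}

lemma isClosed_cantorStage (n : ℕ) : IsClosed (cantorStage p q δ n) := by
  induction n with
  | zero => exact isClosed_Icc
  | succ n ih => exact (ih.preimage (by fun_prop)).union (ih.preimage (by fun_prop))

lemma cantorStage_succ_subset (hpq : p < q) (hδ : 0 < δ) (hδ' : δ < 1 / 2) (n : ℕ) :
    cantorStage p q δ (n + 1) ⊆ cantorStage p q δ n := by
  induction n with
  | zero =>
    rintro x (⟨h1, h2⟩ | ⟨h1, h2⟩)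
    · have e : (x - p) / δ * δ = x - p := div_mul_cancel₀ _ hδ.ne'
      constructor <;> nlinarith
    · have e : (x - q) / δ * δ = x - q := div_mul_cancel₀ _ hδ.ne'
      constructor <;> nlinarith
  | succ n ih => exact union_subset_union (preimage_mono ih) (preimage_mono ih)

lemma antitone_cantorStage (hpq : p < q) (hδ : 0 < δ) (hδ' : δ < 1 / 2) :
    Antitone (cantorStage p q δ) :=
  antitone_nat_of_succ_le (cantorStage_succ_subset hpq hδ hδ')

lemma disjoint_cantorStage (hpq : p < q) (hδ : 0 < δ) (hδ' : δ < 1 / 2) (n : ℕ) :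
    Disjoint ((fun x => p + (x - p) / δ) ⁻¹' cantorStage p q δ n)
      ((fun x => q + (x - q) / δ) ⁻¹' cantorStage p q δ n) := by
  rw [Set.disjoint_left]
  intro x h1 h2
  have h1' := (antitone_cantorStage hpq hδ hδ' (Nat.zero_le n) h1).2
  have h2' := (antitone_cantorStage hpq hδ hδ' (Nat.zero_le n) h2).1
  have e1 : (x - p) / δ * δ = x - p := div_mul_cancel₀ _ hδ.ne'
  have e2 : (x - q) / δ * δ = x - q := div_mul_cancel₀ _ hδ.ne'
  simp only at h1' h2'
  nlinarith

lemma volume_preimage_dilation (hδ : 0 < δ) (e : ℝ) (s : Set ℝ) :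
    volume ((fun x => e + (x - e) / δ) ⁻¹' s) = ENNReal.ofReal δ * volume s := by
  have h : (fun x => e + (x - e) / δ) ⁻¹' s = AffineMap.homothety e δ '' s := by
    ext x
    constructor
    · intro hx
      refine ⟨_, hx, ?_⟩
      simp [AffineMap.homothety_apply, mul_div_cancel₀ _ hδ.ne']
    · rintro ⟨y, hy, rfl⟩
      simpa [AffineMap.homothety_apply, hδ.ne'] using hy
  rw [h, Measure.addHaar_image_homothety]
  simp [abs_of_pos hδ]

lemma volume_cantorStage_le (hδ : 0 < δ) (n : ℕ) :
    volume (cantorStage p q δ n) ≤ ENNReal.ofReal (2 * δ) ^ n * ENNReal.ofReal (q - p) := by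
  induction n with
  | zero => simp [cantorStage]
  | succ n ih =>
    refine (measure_union_le _ _).trans ?_
    rw [volume_preimage_dilation hδ, volume_preimage_dilation hδ, ← two_mul, ← mul_assoc,
      pow_succ', mul_assoc (ENNReal.ofReal (2 * δ)), ENNReal.ofReal_mul zero_le_two,
      ENNReal.ofReal_ofNat]
    rw [ENNReal.ofReal_mul zero_le_two, ENNReal.ofReal_ofNat] at ih
    gcongr

lemma exists_Icc_subset_cantorStage (hδ : 0 < δ) (n : ℕ) {x : ℝ}
    (hx : x ∈ cantorStage p q δ n) :
    ∃ e, x ∈ Icc e (e + δ ^ n * (q - p)) ∧ Icc e (e + δ ^ n * (q - p)) ⊆ cantorStage p q δ n := by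
  have key (s : Set ℝ) (o l x : ℝ)
      (h : ∃ e, o + (x - o) / δ ∈ Icc e (e + l) ∧ Icc e (e + l) ⊆ s) :
      ∃ e, x ∈ Icc e (e + δ * l) ∧
        Icc e (e + δ * l) ⊆ (fun x => o + (x - o) / δ) ⁻¹' s := by
    obtain ⟨e, ⟨h1, h2⟩, h3⟩ := h
    have aux (y : ℝ) : (e ≤ o + (y - o) / δ ↔ o + δ * (e - o) ≤ y) ∧
        (o + (y - o) / δ ≤ e + l ↔ y ≤ o + δ * (e - o) + δ * l) := by
      have e1 : (y - o) / δ * δ = y - o := div_mul_cancel₀ _ hδ.ne'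
      refine ⟨⟨fun h => by nlinarith, fun h => ?_⟩, ⟨fun h => by nlinarith, fun h => ?_⟩⟩
      · rw [← sub_le_iff_le_add', le_div_iff₀ hδ]; linarith
      · rw [← le_sub_iff_add_le', div_le_iff₀ hδ]; linarith
    refine ⟨o + δ * (e - o), ⟨(aux x).1.1 h1, (aux x).2.1 h2⟩, fun y hy => h3 ?_⟩
    exact ⟨(aux y).1.2 hy.1, (aux y).2.2 hy.2⟩
  induction n generalizing x with
  | zero => exact ⟨p, by simpa [cantorStage] using hx, by simp [cantorStage]⟩
  | succ n ih =>
    rw [pow_succ', mul_assoc]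
    rcases hx with hx | hx
    · obtain ⟨e, h1, h2⟩ := key _ p _ x (ih hx)
      exact ⟨e, h1, h2.trans subset_union_left⟩
    · obtain ⟨e, h1, h2⟩ := key _ q _ x (ih hx)
      exact ⟨e, h1, h2.trans subset_union_right⟩

lemma exists_measures_preimage_dilation (hδ : 0 < δ) (o : ℝ) {s : Set ℝ} {σ τ : Measure ℝ}
    (h : ∀ x, s.indicator 1 x = σ.real (Iic x) - τ.real (Iio x)) (x : ℝ) :
    ((fun x => o + (x - o) / δ) ⁻¹' s).indicator 1 x =
      (σ.map fun x => o + δ * (x - o)).real (Iic x) -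
        (τ.map fun x => o + δ * (x - o)).real (Iio x) := by
  have hm : Measurable fun x => o + δ * (x - o) := by fun_prop
  have e1 : (fun x => o + δ * (x - o)) ⁻¹' Iic x = Iic (o + (x - o) / δ) := by
    ext y
    simp only [mem_preimage, mem_Iic]
    rw [← sub_le_iff_le_add', le_div_iff₀ hδ, ← le_sub_iff_add_le', mul_comm]
  have e2 : (fun x => o + δ * (x - o)) ⁻¹' Iio x = Iio (o + (x - o) / δ) := by
    ext y
    simp only [mem_preimage, mem_Iio]
    rw [← sub_lt_iff_lt_add', lt_div_iff₀ hδ, ← lt_sub_iff_add_lt', mul_comm]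
  rw [map_measureReal_apply hm measurableSet_Iic, map_measureReal_apply hm measurableSet_Iio,
    e1, e2, ← h]
  rfl

lemma exists_measures_cantorStage (hpq : p < q) (hδ : 0 < δ) (hδ' : δ < 1 / 2) (n : ℕ) :
    ∃ σ τ : Measure ℝ, σ univ ≤ 2 ^ n ∧ τ univ ≤ 2 ^ n ∧
      ∀ x, (cantorStage p q δ n).indicator 1 x = σ.real (Iic x) - τ.real (Iio x) := by
  induction n with
  | zero =>
    refine ⟨Measure.dirac p, Measure.dirac q, by simp, by simp, fun x => ?_⟩
    simp only [cantorStage, measureReal_def, Measure.dirac_apply' _ measurableSet_Iic,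
      Measure.dirac_apply' _ measurableSet_Iio]
    rcases lt_or_ge x p with h1 | h1
    · simp [indicator, h1.not_ge, (h1.trans hpq).not_gt]
    · rcases lt_or_ge q x with h2 | h2
      · simp [indicator, h1, h2, h2.not_ge]
      · simp [indicator, h1, h2, h2.not_gt]
  | succ n ih =>
    obtain ⟨σ, τ, hσ, hτ, h⟩ := ih
    have : IsFiniteMeasure σ := ⟨hσ.trans_lt (by finiteness)⟩
    have : IsFiniteMeasure τ := ⟨hτ.trans_lt (by finiteness)⟩
    refine ⟨(σ.map fun x => p + δ * (x - p)) + (σ.map fun x => q + δ * (x - q)),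
      (τ.map fun x => p + δ * (x - p)) + (τ.map fun x => q + δ * (x - q)), ?_, ?_, fun x => ?_⟩
    · rw [Measure.add_apply, Measure.map_apply (by fun_prop) .univ,
        Measure.map_apply (by fun_prop) .univ, preimage_univ, preimage_univ, pow_succ,
        mul_two]
      gcongr
    · rw [Measure.add_apply, Measure.map_apply (by fun_prop) .univ,
        Measure.map_apply (by fun_prop) .univ, preimage_univ, preimage_univ, pow_succ,
        mul_two]
      gcongr
    · rw [measureReal_add_apply, measureReal_add_apply, cantorStage,
        indicator_union_of_disjoint (disjoint_cantorStage hpq hδ hδ' n)]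
      simp only [exists_measures_preimage_dilation hδ _ h]
      ring

lemma cantorFunction_mem_Icc (hδ : 0 < δ) (hδ' : δ < 1 / 2) (ω : ℕ → Bool) :
    (1 - δ) * Cardinal.cantorFunction δ ω ∈ Icc (0 : ℝ) 1 := by
  have h1 : δ < 1 := by linarith
  have ht := Cardinal.cantorFunction_succ (fun _ => true) hδ.le h1
  have hf := Cardinal.cantorFunction_succ (fun _ => false) hδ.le h1
  have hle := Cardinal.cantorFunction_le (f := ω) (g := fun _ => true) hδ.le h1 (by simp)
  have hge := Cardinal.cantorFunction_le (f := fun _ => false) (g := ω) hδ.le h1 (by simp)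
  simp only [cond_true, cond_false] at ht hf
  constructor <;> nlinarith

lemma cantorFunction_mem_cantorStage (hpq : p < q) (hδ : 0 < δ) (hδ' : δ < 1 / 2) (n : ℕ)
    (ω : ℕ → Bool) :
    p + (q - p) * ((1 - δ) * Cardinal.cantorFunction δ ω) ∈ cantorStage p q δ n := by
  induction n generalizing ω with
  | zero =>
    obtain ⟨h1, h2⟩ := cantorFunction_mem_Icc hδ hδ' ω
    constructor <;> nlinarith
  | succ n ih =>
    have h := ih fun k => ω (k + 1)
    rw [Cardinal.cantorFunction_succ ω hδ.le (by linarith)]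
    cases h0 : ω 0
    · left
      simp only [cond_false, mem_preimage]
      convert h using 1
      field_simp
      ring
    · right
      simp only [cond_true, mem_preimage]
      convert h using 1
      field_simp
      ring

lemma not_countable_iInter_cantorStage (hpq : p < q) (hδ : 0 < δ) (hδ' : δ < 1 / 2) :
    ¬ Countable (⋂ n, cantorStage p q δ n) := by
  intro hcount
  let g : (ℕ → Bool) → ⋂ n, cantorStage p q δ n := fun ω =>
    ⟨p + (q - p) * ((1 - δ) * Cardinal.cantorFunction δ ω),
      mem_iInter.2 fun n => cantorFunction_mem_cantorStage hpq hδ hδ' n ω⟩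
  have hg : Function.Injective g := by
    intro ω ω' h
    have h' : p + (q - p) * ((1 - δ) * Cardinal.cantorFunction δ ω) =
      p + (q - p) * ((1 - δ) * Cardinal.cantorFunction δ ω') := congrArg Subtype.val h
    have h1 : q - p ≠ 0 := by linarith
    have h2 : 1 - δ ≠ 0 := by linarith
    exact Cardinal.cantorFunction_injective hδ hδ'
      (mul_left_cancel₀ h2 (mul_left_cancel₀ h1 (add_left_cancel h')))
  have h := Cardinal.mk_le_aleph0_iff.2 hg.countable
  simp only [Cardinal.mk_pi, Cardinal.mk_bool, Cardinal.prod_const, Cardinal.mk_nat,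
    Cardinal.lift_id] at h
  exact (Cardinal.cantor Cardinal.aleph0).not_ge h

lemma volume_iInter_cantorStage (hδ : 0 < δ) (hδ' : δ < 1 / 2) :
    volume (⋂ n, cantorStage p q δ n) = 0 := by
  have h1 : ENNReal.ofReal (2 * δ) < 1 := by
    rw [ENNReal.ofReal_lt_one]; linarith
  have h : Tendsto (fun n => ENNReal.ofReal (2 * δ) ^ n * ENNReal.ofReal (q - p)) atTop (𝓝 0) := by
    simpa using ENNReal.Tendsto.mul_const (ENNReal.tendsto_pow_atTop_nhds_zero_of_lt_one h1)
      (Or.inr (ENNReal.ofReal_ne_top (r := q - p)))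
  exact le_antisymm (ge_of_tendsto' h fun n =>
    (measure_mono (iInter_subset _ n)).trans (volume_cantorStage_le hδ n)) bot_le

end cantorStage

/-- An uncountable closed set carries an atomless probability measure. -/
lemma exists_atomless_probability {C : Set ℝ} (hC : IsClosed C) (hunc : ¬ Countable C) :
    ∃ μ : Measure ℝ, IsProbabilityMeasure μ ∧ NullSingletonClass μ ∧ μ Cᶜ = 0 := by
  have : StandardBorelSpace C := hC.measurableSet.standardBorel
  let e : ℝ ≃ᵐ C := PolishSpace.measurableEquivOfNotCountable not_countable hunc
  have hm : Measurable fun t => (e t : ℝ) := measurable_subtype_coe.comp e.measurable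
  have hP : IsProbabilityMeasure (volume.restrict (Icc (0 : ℝ) 1)) := ⟨by simp⟩
  refine ⟨(volume.restrict (Icc (0 : ℝ) 1)).map fun t => (e t : ℝ),
    Measure.isProbabilityMeasure_map hm.aemeasurable, ⟨fun x => ?_⟩, ?_⟩
  · rw [Measure.map_apply hm (measurableSet_singleton x)]
    refine Set.Subsingleton.measure_zero (fun s hs t ht => ?_) _
    exact e.injective (Subtype.ext (hs.trans ht.symm))
  · rw [Measure.map_apply hm hC.measurableSet.compl]
    have : (fun t => (e t : ℝ)) ⁻¹' Cᶜ = ∅ := by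
      ext t; simp
    rw [this, measure_empty]

lemma tendsto_average_atTop {w : ℝ → ℝ} (hw : Integrable w) (hw0 : ∀ᵐ t, 0 ≤ w t) {x : ℝ}
    (h : ∀ A : ℝ, ∃ e l, 0 < l ∧ x ∈ Icc e (e + l) ∧ ∀ᵐ t, t ∈ Icc e (e + l) → A ≤ w t) :
    Tendsto (fun ε => (∫ t in Ioo (x - ε) (x + ε), w t) / (2 * ε)) (𝓝[>] (0 : ℝ)) atTop := by
  rw [tendsto_atTop]
  intro A
  obtain ⟨e, l, hl, ⟨hx1, hx2⟩, hA⟩ := h (2 * A)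
  filter_upwards [Ioo_mem_nhdsGT (half_pos hl)] with ε ⟨hε, hεl⟩
  obtain ⟨y, hy1, hy2, hy3⟩ :
      ∃ y, e ≤ y ∧ y + ε ≤ e + l ∧ Ioo y (y + ε) ⊆ Ioo (x - ε) (x + ε) := by
    by_cases hc : x + ε ≤ e + l
    · exact ⟨x, hx1, hc, Ioo_subset_Ioo (by linarith) le_rfl⟩
    · exact ⟨x - ε, by linarith, by linarith, Ioo_subset_Ioo le_rfl (by linarith)⟩
  rw [le_div_iff₀ (by positivity)]
  calc A * (2 * ε) = ∫ _ in Ioo y (y + ε), 2 * A := by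
        rw [setIntegral_const]
        simp [hε.le]
        ring
    _ ≤ ∫ t in Ioo y (y + ε), w t := by
        refine setIntegral_mono_on_ae (integrableOn_const (by simp)) hw.integrableOn
          measurableSet_Ioo ?_
        filter_upwards [hA] with t ht hty
        exact ht ⟨by linarith [hty.1], by linarith [hty.2]⟩
    _ ≤ _ := setIntegral_mono_set hw.integrableOn (ae_restrict_of_ae hw0) hy3.eventuallyLE

/-- The sum of the indicators of the stages of the Cantor set, the `n`-th one with weight `B ^ n`. -/
def cantorDensity (p q δ B : ℝ) (x : ℝ) : ℝ≥0∞ :=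
  ∑' n, (cantorStage p q δ n).indicator (fun _ => ENNReal.ofReal (B ^ n)) x

section cantorDensity

variable {p q δ B : ℝ}

lemma measurable_cantorDensity : Measurable (cantorDensity p q δ B) :=
  Measurable.tsum fun n =>
    measurable_const.indicator (isClosed_cantorStage n).measurableSet

lemma lintegral_cantorDensity_ne_top (hδ : 0 < δ) (hB : 0 ≤ B) (hδB : δ * B = 1 / 4) :
    ∫⁻ x, cantorDensity p q δ B x ≠ ⊤ := by
  have h1 : ∫⁻ x, cantorDensity p q δ B x =
      ∑' n, ENNReal.ofReal (B ^ n) * volume (cantorStage p q δ n) := by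
    unfold cantorDensity
    rw [lintegral_tsum fun n =>
      (measurable_const.indicator (isClosed_cantorStage n).measurableSet).aemeasurable]
    congr 1; ext n
    rw [lintegral_indicator_const (isClosed_cantorStage n).measurableSet]
  have h2 (n : ℕ) : ENNReal.ofReal (B ^ n) * volume (cantorStage p q δ n) ≤
      ENNReal.ofReal ((1 / 2) ^ n) * ENNReal.ofReal (q - p) := by
    calc _ ≤ ENNReal.ofReal (B ^ n) *
          (ENNReal.ofReal (2 * δ) ^ n * ENNReal.ofReal (q - p)) := by
          gcongr; exact volume_cantorStage_le hδ n
      _ = _ := by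
          rw [← mul_assoc, ← ENNReal.ofReal_pow (by positivity),
            ← ENNReal.ofReal_mul (by positivity), ← mul_pow]
          congr 3
          linarith
  rw [h1]
  refine ne_top_of_le_ne_top ?_ (ENNReal.tsum_le_tsum h2)
  rw [ENNReal.tsum_mul_right]
  exact ENNReal.mul_ne_top
    (summable_geometric_of_lt_one (by norm_num) (by norm_num)).tsum_ofReal_ne_top
    ENNReal.ofReal_ne_top

lemma ofReal_pow_le_cantorDensity {n : ℕ} {x : ℝ} (hx : x ∈ cantorStage p q δ n) :
    ENNReal.ofReal (B ^ n) ≤ cantorDensity p q δ B x := by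
  refine le_trans ?_ (ENNReal.le_tsum n)
  simp [hx]

lemma cantorDensity_of_notMem_Icc (hpq : p < q) (hδ : 0 < δ) (hδ' : δ < 1 / 2) {x : ℝ}
    (hx : x ∉ Icc p q) : cantorDensity p q δ B x = 0 := by
  have (n : ℕ) : x ∉ cantorStage p q δ n :=
    fun h => hx (antitone_cantorStage hpq hδ hδ' (Nat.zero_le n) h)
  simp [cantorDensity, this]

lemma exists_mem_cantorStage_iff_lt (hpq : p < q) (hδ : 0 < δ) (hδ' : δ < 1 / 2) {x : ℝ}
    (hx : x ∉ ⋂ n, cantorStage p q δ n) : ∃ N, ∀ n, x ∈ cantorStage p q δ n ↔ n < N := by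
  classical
  simp only [mem_iInter, not_forall] at hx
  refine ⟨Nat.find hx, fun n => ⟨fun h => ?_, fun h => not_not.1 (Nat.find_min hx h)⟩⟩
  by_contra! hn
  exact Nat.find_spec hx (antitone_cantorStage hpq hδ hδ' hn h)

lemma toReal_cantorDensity_eq (hB : 0 ≤ B) {x : ℝ} {N : ℕ}
    (hN : ∀ n, x ∈ cantorStage p q δ n ↔ n < N) :
    (cantorDensity p q δ B x).toReal = ∑ n ∈ Finset.range N, B ^ n := by
  rw [cantorDensity, tsum_eq_sum (s := Finset.range N) (by
    intro n hn
    simp only [Finset.mem_range] at hn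
    simp [hN, hn])]
  rw [ENNReal.toReal_sum (by intro n hn; simp [indicator]; split_ifs <;> simp)]
  refine Finset.sum_congr rfl fun n hn => ?_
  rw [indicator_of_mem ((hN n).2 (Finset.mem_range.1 hn)), ENNReal.toReal_ofReal (by positivity)]

/-- A function of the stage at which a point leaves the Cantor set telescopes into a sum of
multiples of the indicators of the stages. -/
lemma hasSum_comp_cantorDensity (hpq : p < q) (hδ : 0 < δ) (hδ' : δ < 1 / 2) (hB : 0 ≤ B)
    (Ψ : ℝ → ℝ) {x : ℝ} (hx : x ∉ ⋂ n, cantorStage p q δ n) :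
    HasSum (fun n => (Ψ (∑ k ∈ Finset.range (n + 1), B ^ k) - Ψ (∑ k ∈ Finset.range n, B ^ k)) *
      (cantorStage p q δ n).indicator 1 x)
      (Ψ (cantorDensity p q δ B x).toReal - Ψ 0) := by
  obtain ⟨N, hN⟩ := exists_mem_cantorStage_iff_lt hpq hδ hδ' hx
  have h : ∑ n ∈ Finset.range N,
      (Ψ (∑ k ∈ Finset.range (n + 1), B ^ k) - Ψ (∑ k ∈ Finset.range n, B ^ k)) *
      (cantorStage p q δ n).indicator 1 x = Ψ (cantorDensity p q δ B x).toReal - Ψ 0 := by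
    have := Finset.sum_range_sub (fun n => Ψ (∑ k ∈ Finset.range n, B ^ k)) N
    rw [toReal_cantorDensity_eq hB hN]
    simp only [Finset.range_zero, Finset.sum_empty] at this
    rw [← this]
    refine Finset.sum_congr rfl fun n hn => ?_
    simp [(hN n).2 (Finset.mem_range.1 hn)]
  rw [← h]
  refine hasSum_sum_of_ne_finset_zero fun n hn => ?_
  rw [Finset.mem_range] at hn
  simp [hN, hn]

end cantorDensity

lemma isFiniteMeasure_sum_smul {α : Type*} [MeasurableSpace α] {d : ℕ → ℝ} (hd : ∀ n, 0 ≤ d n)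
    (hsum : Summable fun n => d n * 2 ^ n) {σ : ℕ → Measure α} (hσ : ∀ n, σ n univ ≤ 2 ^ n) :
    IsFiniteMeasure (Measure.sum fun n => ENNReal.ofReal (d n) • σ n) := by
  constructor
  rw [Measure.sum_apply _ .univ]
  refine lt_of_le_of_lt (ENNReal.tsum_le_tsum fun n => ?_) hsum.tsum_ofReal_lt_top
  rw [ENNReal.ofReal_mul (hd n), ENNReal.ofReal_pow zero_le_two, ENNReal.ofReal_ofNat]
  simp only [Measure.smul_apply, smul_eq_mul]
  gcongr
  exact hσ n

lemma hasSum_measureReal_sum_smul {α : Type*} [MeasurableSpace α] {d : ℕ → ℝ} (hd : ∀ n, 0 ≤ d n)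
    (hsum : Summable fun n => d n * 2 ^ n) {σ : ℕ → Measure α} (hσ : ∀ n, σ n univ ≤ 2 ^ n)
    {s : Set α} (hs : MeasurableSet s) :
    HasSum (fun n => d n * (σ n).real s)
      ((Measure.sum fun n => ENNReal.ofReal (d n) • σ n).real s) := by
  have := isFiniteMeasure_sum_smul hd hsum hσ
  have hne : ∑' n, (ENNReal.ofReal (d n) • σ n) s ≠ ⊤ := by
    rw [← Measure.sum_apply _ hs]; finiteness
  have h := ENNReal.hasSum_toReal hne
  rw [← ENNReal.tsum_toReal_eq (ENNReal.ne_top_of_tsum_ne_top hne), ← Measure.sum_apply _ hs] at h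
  simpa [measureReal_def, ENNReal.toReal_ofReal, hd] using h

lemma Psi1_mono {ψ : ℝ → ℝ} (hψ : PsiHyp ψ) : Monotone (Psi1 ψ) := fun _ _ h =>
  setIntegral_mono_set hψ.integrable.integrableOn (.of_forall fun x => (hψ.pos x).le)
    (Iic_subset_Iic.2 h).eventuallyLE

lemma Psi1_sub_le {ψ : ℝ → ℝ} (hψ : PsiHyp ψ) {c α : ℝ} (hα : 1 < α)
    (hdecay : ∀ t : ℝ, 1 ≤ t → ψ t ≤ c / t ^ α) {t : ℝ} (ht : 1 ≤ t) (s : ℝ) :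
    Psi1 ψ s - Psi1 ψ t ≤ c / (α - 1) * t ^ (1 - α) := by
  have ht0 : 0 < t := by linarith
  have h1 : Psi1 ψ s ≤ ∫ x, ψ x :=
    setIntegral_le_integral hψ.integrable (.of_forall fun x => (hψ.pos x).le)
  have h2 : (∫ x, ψ x) - Psi1 ψ t = ∫ x in Ioi t, ψ x := by
    have := intervalIntegral.integral_Iic_add_Ioi (b := t) hψ.integrable.integrableOn
      hψ.integrable.integrableOn
    rw [Psi1]; linarith
  have h3 : ∫ x in Ioi t, ψ x ≤ ∫ x in Ioi t, c * x ^ (-α) := by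
    refine setIntegral_mono_on hψ.integrable.integrableOn
      ((integrableOn_Ioi_rpow_of_lt (by linarith) ht0).const_mul c) measurableSet_Ioi ?_
    intro x hx
    have hx' : t < x := hx
    refine (hdecay x (by linarith)).trans_eq ?_
    rw [Real.rpow_neg (by linarith), div_eq_mul_inv]
  rw [integral_const_mul, integral_Ioi_rpow_of_lt (by linarith) ht0] at h3
  have h4 : c * (-t ^ (-α + 1) / (-α + 1)) = c / (α - 1) * t ^ (1 - α) := by
    rw [show -α + 1 = -(α - 1) by ring, show 1 - α = -(α - 1) by ring]
    have : α - 1 ≠ 0 := by linarith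
    field_simp
  linarith

lemma summable_Psi1_increments {ψ : ℝ → ℝ} (hψ : PsiHyp ψ) {c α B : ℝ} (hα : 1 < α)
    (hdecay : ∀ t : ℝ, 1 ≤ t → ψ t ≤ c / t ^ α) (hB : 1 ≤ B) (hBα : B ^ (1 - α) = 1 / 4) :
    Summable fun n => (Psi1 ψ (∑ k ∈ Finset.range (n + 1), B ^ k) -
      Psi1 ψ (∑ k ∈ Finset.range n, B ^ k)) * 2 ^ n := by
  have hB0 : 0 ≤ B := by linarith
  rw [← summable_nat_add_iff 1]
  refine Summable.of_nonneg_of_le (fun n => ?_) (fun n => ?_)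
    ((summable_geometric_of_lt_one (r := 1 / 2) (by norm_num) (by norm_num)).mul_left
      (c / (α - 1) * 2))
  · refine mul_nonneg (sub_nonneg.2 (Psi1_mono hψ ?_)) (by positivity)
    rw [Finset.sum_range_succ _ (n + 1)]
    linarith [pow_nonneg hB0 (n + 1)]
  · have h1 : B ^ n ≤ ∑ k ∈ Finset.range (n + 1), B ^ k :=
      Finset.single_le_sum (f := fun k => B ^ k) (fun k _ => pow_nonneg hB0 k)
        (Finset.self_mem_range_succ n)
    have h2 : (B ^ n) ^ (1 - α) = (1 / 4) ^ n := by
      rw [← Real.rpow_natCast, ← Real.rpow_mul hB0, mul_comm, Real.rpow_mul hB0, hBα,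
        Real.rpow_natCast]
    calc _ ≤ (c / (α - 1) * (1 / 4) ^ n) * 2 ^ (n + 1) := by
          gcongr
          rw [← h2]
          exact (sub_le_sub_left (Psi1_mono hψ h1) _).trans
            (Psi1_sub_le hψ hα hdecay (one_le_pow₀ hB) _)
      _ = c / (α - 1) * 2 * ((1 / 4) ^ n * 2 ^ n) := by ring
      _ = _ := by rw [← mul_pow]; norm_num

/-- `Ψ₁` of the density is of bounded variation. -/
lemma exists_isDerivMeasures_Psi1_cantorDensity {ψ : ℝ → ℝ} (hψ : PsiHyp ψ) {c α B p q δ : ℝ}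
    (hα : 1 < α) (hdecay : ∀ t : ℝ, 1 ≤ t → ψ t ≤ c / t ^ α) (hB : 1 ≤ B)
    (hBα : B ^ (1 - α) = 1 / 4) (hpq : p < q) (hδ : 0 < δ) (hδ' : δ < 1 / 2) {a b : ℝ} {w : ℝ → ℝ}
    (hw : ∀ᵐ x, w x = (cantorDensity p q δ B x).toReal) :
    ∃ νp νn : Measure ℝ, IsDerivMeasures a b (fun x => Psi1 ψ (w x)) νp νn := by
  have hB0 : 0 ≤ B := by linarith
  have hsum := summable_Psi1_increments hψ hα hdecay hB hBα
  set d : ℕ → ℝ := fun n => Psi1 ψ (∑ k ∈ Finset.range (n + 1), B ^ k) -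
      Psi1 ψ (∑ k ∈ Finset.range n, B ^ k) with hd_def
  have hd (n : ℕ) : 0 ≤ d n := by
    refine sub_nonneg.2 (Psi1_mono hψ ?_)
    rw [Finset.sum_range_succ]
    linarith [pow_nonneg hB0 n]
  choose σ τ hσ hτ hστ using exists_measures_cantorStage hpq hδ hδ'
  have := isFiniteMeasure_sum_smul hd hsum hσ
  have := isFiniteMeasure_sum_smul hd hsum hτ
  refine exists_isDerivMeasures (Measure.sum fun n => ENNReal.ofReal (d n) • σ n)
    (Measure.sum fun n => ENNReal.ofReal (d n) • τ n) (K := Psi1 ψ 0) (ae_restrict_of_ae ?_)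
  have hC : ∀ᵐ x, x ∉ ⋂ n, cantorStage p q δ n :=
    measure_eq_zero_iff_ae_notMem.1 (volume_iInter_cantorStage hδ hδ')
  filter_upwards [hw, hC] with x hx hxC
  have h1 := hasSum_comp_cantorDensity hpq hδ hδ' hB0 (Psi1 ψ) hxC
  have h2 := (hasSum_measureReal_sum_smul hd hsum hσ (measurableSet_Iic (a := x))).sub
    (hasSum_measureReal_sum_smul hd hsum hτ (measurableSet_Iio (a := x)))
  simp only [← mul_sub, ← hστ] at h2
  have := h1.unique h2
  rw [hx]
  linarith

/-- under the additional algebraic decay `ψ(t) ≤ c/t^α` (`t ≥ 1`, `c > 0`,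
`α > 1`), the space `X¹_ψ(]a,b[)` contains a function whose derivative has a
nontrivial Cantor part. -/
theorem statement_0 (a b c α : ℝ) (hab : a < b) (hc : 0 < c) (hα : 1 < α)
    (ψ : ℝ → ℝ) (hψ : PsiHyp ψ)
    (hdecay : ∀ t : ℝ, 1 ≤ t → ψ t ≤ c / t ^ α) :
    ∃ (u : ℝ → ℝ) (μp μn : Measure ℝ),
      MemX1 ψ a b u μp μn ∧
      ¬ (cantorPos a b u μp = 0 ∧ cantorNeg a b u μn = 0) := by
  obtain ⟨p, hap, hpb⟩ := exists_between hab
  obtain ⟨q, hpq, hqb⟩ := exists_between hpb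
  have hα1 : α - 1 ≠ 0 := by linarith
  set B : ℝ := 4 ^ (1 / (α - 1)) with hB_def
  have hB : 1 < B := Real.one_lt_rpow (by norm_num) (by apply div_pos <;> linarith)
  have hB0 : 0 < B := by linarith
  have hBα : B ^ (1 - α) = 1 / 4 := by
    rw [hB_def, ← Real.rpow_mul (by norm_num),
      show 1 / (α - 1) * (1 - α) = -1 by field_simp; ring, Real.rpow_neg_one]
    norm_num
  set δ : ℝ := 1 / (4 * B)
  have hδB : δ * B = 1 / 4 := by simp only [δ]; field_simp
  have hδ : 0 < δ := by positivity
  have hδ' : δ < 1 / 2 := by nlinarith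
  set C := ⋂ n, cantorStage p q δ n
  have hCsub : C ⊆ Icc p q := iInter_subset (cantorStage p q δ) 0
  have hCclosed : IsClosed C := isClosed_iInter isClosed_cantorStage
  have hCvol : volume C = 0 := volume_iInter_cantorStage hδ hδ'
  have hIcc : Icc p q ⊆ Ioo a b := Icc_subset_Ioo hap hqb
  obtain ⟨μC, hprob, hatom, hμC⟩ :=
    exists_atomless_probability hCclosed (not_countable_iInter_cantorStage hpq hδ hδ')
  set F := cantorDensity p q δ B
  have hFmeas : Measurable F := measurable_cantorDensity
  have hFint : ∫⁻ x, F x ≠ ⊤ := lintegral_cantorDensity_ne_top hδ hB0.le hδB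
  have hFfin : ∀ᵐ x, F x < ⊤ := ae_lt_top hFmeas hFint
  have hfinF : IsFiniteMeasure (volume.withDensity F) := isFiniteMeasure_withDensity hFint
  set μ := μC + volume.withDensity F with hμ
  have hatomμ : NullSingletonClass μ := ⟨fun x => by
    rw [hμ, Measure.add_apply, measure_singleton,
      withDensity_absolutelyContinuous volume F (measure_singleton x), add_zero]⟩
  have hsing : μC ⟂ₘ volume := ⟨Cᶜ, hCclosed.measurableSet.compl, hμC, by rwa [compl_compl]⟩
  have hsp : μ.singularPart volume = μC := (Measure.eq_singularPart hFmeas hsing hμ).symm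
  have hua : ∀ᵐ x, uaD μ 0 x = (F x).toReal := by
    filter_upwards [Measure.eq_rnDeriv hFmeas hsing hμ, Measure.rnDeriv_zero volume] with x h1 h2
    simp [uaD, ← h1, h2]
  have hsupp : μ (Ioo a b)ᶜ = 0 := by
    rw [hμ, Measure.add_apply, measure_mono_null (compl_subset_compl.2 (hCsub.trans hIcc)) hμC,
      zero_add, withDensity_apply _ measurableSet_Ioo.compl]
    refine setLIntegral_eq_zero measurableSet_Ioo.compl fun x hx => ?_
    exact cantorDensity_of_notMem_Icc hpq hδ hδ' fun h => hx (hIcc h)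
  have hjump : jumpSet a b (fun x => μ.real (Iic x)) = ∅ := jumpSet_eq_empty_of_continuous
    (monotone_measureReal_Iic μ) (continuous_measureReal_Iic μ) a b
  have hcp : cantorPos a b (fun x => μ.real (Iic x)) μ = μC := by
    rw [cantorPos, hjump, hsp, compl_empty, Measure.restrict_univ]
  have hZ : C ⊆ ZPlus a b (uaD μ 0) := by
    intro x hx
    refine ⟨hIcc (hCsub hx), tendsto_average_atTop ?_ ?_ fun A => ?_⟩
    · exact (integrable_toReal_of_lintegral_ne_top hFmeas.aemeasurable hFint).congr
        (hua.mono fun x hx => hx.symm)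
    · filter_upwards [hua] with t ht
      rw [ht]
      exact ENNReal.toReal_nonneg
    · obtain ⟨n, hn⟩ := pow_unbounded_of_one_lt A hB
      obtain ⟨e, h1, h2⟩ := exists_Icc_subset_cantorStage hδ n (mem_iInter.1 hx n)
      refine ⟨e, δ ^ n * (q - p), mul_pos (pow_pos hδ n) (sub_pos.2 hpq), h1, ?_⟩
      filter_upwards [hua, hFfin] with t ht hFt hte
      rw [ht]
      exact hn.le.trans ((ENNReal.ofReal_le_iff_le_toReal hFt.ne).1
        (ofReal_pow_le_cantorDensity (h2 hte)))
  refine ⟨fun x => μ.real (Iic x), μ, 0, ⟨isDerivMeasures_measureReal_Iic μ hsupp,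
    exists_isDerivMeasures_Psi1_cantorDensity hψ hα hdecay hB.le hBα hpq hδ hδ' hua, ?_, ?_⟩, ?_⟩
  · rw [hcp]
    exact measure_mono_null (compl_subset_compl.2 hZ) hμC
  · simp [cantorNeg]
  · rw [hcp]
    exact fun h => IsProbabilityMeasure.ne_zero μC h.1
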